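/- arXiv:1706.07991 — 4 statements merged into one kernel-verified Lean document; each statement's English description precedes it below -/
import Mathlib

section
/- Let 1 < α < 2 and let n be a natural number. Then the tail series ∑_{j=n+1}^∞ g^α_j converges and equals −g^{α−1}_n. -/
/-- The Grünwald weights `g^α_i = (-1)^i (α choose i)`, defined by the recursion
`g^α_0 = 1`, `g^α_i = g^α_{i-1} · (i-1-α)/i` for `i ≥ 1`. -/
noncomputable def grunwald (α : ℝ) : ℕ → ℝ
  | 0 => 1
  | (i + 1) => grunwald α i * ((i : ℝ) - α) / ((i : ℝ) + 1)

theorem grunwald_succ_eq (α : ℝ) (j : ℕ) :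
    grunwald α (j + 1) = -α * grunwald (α - 1) j / ((j : ℝ) + 1) := by
  induction j with
  | zero => simp [grunwald]
  | succ j ih =>
    rw [grunwald, ih, grunwald]
    have h1 : (j : ℝ) + 1 ≠ 0 := by positivity
    have h2 : ((j : ℝ) + 1) + 1 ≠ 0 := by positivity
    push_cast
    field_simp
    ring

theorem grunwald_succ_diff (α : ℝ) (j : ℕ) :
    grunwald α (j + 1) = grunwald (α - 1) (j + 1) - grunwald (α - 1) j := by
  rw [grunwald_succ_eq, grunwald]
  have h1 : (j : ℝ) + 1 ≠ 0 := by positivity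
  field_simp
  ring

theorem grunwald_nonneg_aux (α : ℝ) (hα₁ : 1 < α) (hα₂ : α < 2) (k : ℕ) :
    0 ≤ grunwald α (k + 2) := by
  induction k with
  | zero =>
    simp only [grunwald]
    norm_num
    nlinarith
  | succ k ih =>
    rw [show k + 1 + 2 = (k + 2) + 1 by ring, grunwald]
    have hk : (0 : ℝ) ≤ k := Nat.cast_nonneg k
    have : (0 : ℝ) ≤ ((k + 2 : ℕ) : ℝ) - α := by push_cast; linarith
    positivity

theorem grunwald_abs_le (b : ℝ) (h0 : 0 < b) (h1 : b < 1) (j : ℕ) :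
    |grunwald b (j + 1)| ≤ 1 / ((j : ℝ) + 1) := by
  induction j with
  | zero => simp [grunwald, abs_of_pos h0, h1.le]
  | succ j ih =>
    have hj : (0 : ℝ) ≤ j := Nat.cast_nonneg j
    have hj1 : (0 : ℝ) < (j : ℝ) + 1 := by positivity
    rw [grunwald, abs_div, abs_mul]
    push_cast
    rw [abs_of_nonneg (by linarith : (0 : ℝ) ≤ (j : ℝ) + 1 - b),
      abs_of_pos (by positivity : (0 : ℝ) < (j : ℝ) + 1 + 1)]
    apply div_le_div_of_nonneg_right _ (by positivity)
    rw [le_div_iff₀ hj1] at ih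
    exact le_trans (mul_le_mul_of_nonneg_left (by linarith) (abs_nonneg _)) ih

theorem grunwald_tendsto_zero (b : ℝ) (h0 : 0 < b) (h1 : b < 1) :
    Filter.Tendsto (grunwald b) Filter.atTop (nhds 0) := by
  rw [← Filter.tendsto_add_atTop_iff_nat 1]
  exact squeeze_zero_norm (fun j => by simpa using grunwald_abs_le b h0 h1 j)
    tendsto_one_div_add_atTop_nhds_zero_nat |>.congr (fun _ => rfl)

theorem grunwald_tail_pos (α : ℝ) (hα₁ : 1 < α) (hα₂ : α < 2) (n : ℕ) :
    HasSum (fun k : ℕ => grunwald α (n + 1 + 1 + k)) (-grunwald (α - 1) (n + 1)) := by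
  rw [hasSum_iff_tendsto_nat_of_nonneg]
  · have hs : ∀ N : ℕ, ∑ k ∈ Finset.range N, grunwald α (n + 1 + 1 + k)
        = grunwald (α - 1) (N + (n + 1)) - grunwald (α - 1) (n + 1) := by
      intro N
      induction N with
      | zero => simp
      | succ N ih =>
        rw [Finset.sum_range_succ, ih, show n + 1 + 1 + N = (N + (n + 1)) + 1 by ring,
          grunwald_succ_diff α (N + (n + 1)), show N + 1 + (n + 1) = (N + (n + 1)) + 1 by ring]
        ring
    simp only [hs]
    have := ((Filter.tendsto_add_atTop_iff_nat (n + 1)).2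
      (grunwald_tendsto_zero (α - 1) (by linarith) (by linarith))).sub_const
      (grunwald (α - 1) (n + 1))
    simpa using this
  · intro k
    rw [show n + 1 + 1 + k = (n + k) + 2 by ring]
    exact grunwald_nonneg_aux α hα₁ hα₂ _

/-- For `1 < α < 2` and any natural `n`, the tail series `∑_{j=n+1}^∞ g^α_j`
converges and equals `−g^{α-1}_n`. -/
theorem grunwald_tail_sum (α : ℝ) (hα₁ : 1 < α) (hα₂ : α < 2) (n : ℕ) :
    HasSum (fun k : ℕ => grunwald α (n + 1 + k)) (-grunwald (α - 1) n) := by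
  cases n with
  | succ n => exact grunwald_tail_pos α hα₁ hα₂ n
  | zero =>
    rw [← hasSum_nat_add_iff' 1]
    have h := grunwald_tail_pos α hα₁ hα₂ 0
    have e1 : (fun k : ℕ => grunwald α (0 + 1 + (k + 1)))
        = fun k : ℕ => grunwald α (0 + 1 + 1 + k) := by
      funext k
      congr 1
      ring
    have e2 : -grunwald (α - 1) 0 - ∑ i ∈ Finset.range 1, grunwald α (0 + 1 + i)
        = -grunwald (α - 1) (0 + 1) := by
      simp [grunwald]
      ring
    rw [e1, e2]
    exact h
end

section
/- Let 1 < α < 2. Then n^{α−1} · g^{α−2}_n → (2−α)/Γ(3−α) as n → ∞; that is, the Grünwald weights of order α−2 satisfy g^{α−2}_n ∼ ((2−α)/Γ(3−α)) · n^{1−α} as n → ∞. -/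
open Filter

lemma grunwald_prod (a : ℝ) (n : ℕ) :
    grunwald a n * (n.factorial : ℝ) = ∏ j ∈ Finset.range n, (-a + (j : ℝ)) := by
  induction n with
  | zero => simp [grunwald]
  | succ k ih =>
    rw [Finset.prod_range_succ, ← ih, grunwald, Nat.factorial_succ]
    push_cast
    have : (k : ℝ) + 1 ≠ 0 := by positivity
    field_simp
    ring

/-- For `1 < α < 2`, `n^{α-1} · g^{α-2}_n → (2−α)/Γ(3−α)` as `n → ∞`. -/
theorem grunwald_asymptotics' (α : ℝ) (hα₁ : 1 < α) (hα₂ : α < 2) :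
    Tendsto (fun n : ℕ => (n : ℝ) ^ (α - 1) * grunwald (α - 2) n) atTop
      (nhds ((2 - α) / Real.Gamma (3 - α))) := by
  have hs : 0 < 2 - α := by linarith
  have hG : Real.Gamma (3 - α) = (2 - α) * Real.Gamma (2 - α) := by
    rw [← Real.Gamma_add_one hs.ne']
    congr 1
    ring
  have hΓ := Real.Gamma_pos_of_pos hs
  have hlim : (2 - α) / Real.Gamma (3 - α) = 1 / Real.Gamma (2 - α) := by
    rw [hG]
    field_simp
  rw [hlim]
  have h1 : Tendsto (fun n : ℕ => (n : ℝ) / ((n : ℝ) + (2 - α))) atTop (nhds 1) :=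
    tendsto_natCast_div_add_atTop (2 - α)
  refine (h1.div (Real.GammaSeq_tendsto_Gamma (2 - α)) hΓ.ne').congr' ?_
  filter_upwards [eventually_gt_atTop 0] with n hn
  have hn' : (0 : ℝ) < n := by exact_mod_cast hn
  have hP := grunwald_prod (α - 2) n
  rw [neg_sub] at hP
  have hf : (0 : ℝ) < n.factorial := by exact_mod_cast n.factorial_pos
  have hpow : (n : ℝ) ^ (α - 1) * (n : ℝ) ^ (2 - α) = n := by
    rw [← Real.rpow_add hn']
    norm_num
  have hp : 0 < (n : ℝ) ^ (2 - α) := Real.rpow_pos_of_pos hn' _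
  have hq : (n : ℝ) + (2 - α) ≠ 0 := by positivity
  have hq' : (2 - α) + (n : ℝ) ≠ 0 := by positivity
  have hPpos : 0 < ∏ j ∈ Finset.range n, (2 - α + (j : ℝ)) :=
    Finset.prod_pos fun j _ => by positivity
  simp only [Pi.div_apply]
  rw [Real.GammaSeq, Finset.prod_range_succ, eq_div_of_mul_eq hf.ne' hP]
  generalize (∏ j ∈ Finset.range n, (2 - α + (j : ℝ))) = P at *
  rw [div_div_eq_mul_div, div_mul_eq_mul_div, div_div, mul_div_assoc', div_eq_div_iff
    (by positivity) hf.ne']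
  generalize (n : ℝ) ^ (2 - α) = A at *
  generalize (n : ℝ) ^ (α - 1) = B at *
  linear_combination (-(P * ((2 - α) + n) * n.factorial)) * hpow
end

section
/- Let 1 < α < 2, let x > 0, and let f : ℝ → ℝ be continuous at 0. With j = j(h) = ⌊x/h⌋ + 1, the correction term in the shifted Grünwald formula for the Patie–Simon derivative satisfies lim_{h→0⁺} h^{−α} · g^{α−1}_{j(h)+1} · f(x − j(h)·h) = f(0) · x^{−α}/Γ(1−α). -/
open Filter

lemma grunwald_eq_prod (s : ℝ) (n : ℕ) :
    grunwald (-s) n = (∏ j ∈ Finset.range n, (s + j)) / (n.factorial : ℝ) := by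
  induction n with
  | zero => simp [grunwald]
  | succ k ih =>
    have hk : (k.factorial : ℝ) ≠ 0 := by exact_mod_cast k.factorial_ne_zero
    have hk1 : (k : ℝ) + 1 ≠ 0 := by positivity
    rw [grunwald, ih, Finset.prod_range_succ, Nat.factorial_succ]
    push_cast
    field_simp
    ring

lemma grunwald_eq_gammaSeq (s : ℝ) (n : ℕ) (hn : 0 < n) :
    grunwald (-s) (n + 1) = (n : ℝ) ^ s / ((n : ℝ) + 1) * (Real.GammaSeq s n)⁻¹ := by
  have hk : (n.factorial : ℝ) ≠ 0 := by exact_mod_cast n.factorial_ne_zero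
  have hk1 : (n : ℝ) + 1 ≠ 0 := by positivity
  have hp : (n : ℝ) ^ s ≠ 0 := (Real.rpow_pos_of_pos (by exact_mod_cast hn) s).ne'
  rw [grunwald_eq_prod, Real.GammaSeq, inv_div, Nat.factorial_succ]
  push_cast
  field_simp

/-- For `1 < α < 2`, `x > 0`, `f` continuous at `0`, and `j(h) = ⌊x/h⌋ + 1`,
`h^{-α} · g^{α-1}_{j(h)+1} · f(x − j(h)h) → f(0) · x^{-α}/Γ(1−α)` as `h → 0⁺`. -/
theorem grunwald_correction_term_PatieSimon (α : ℝ) (hα₁ : 1 < α) (hα₂ : α < 2)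
    (x : ℝ) (hx : 0 < x) (f : ℝ → ℝ) (hf : ContinuousAt f 0) :
    Tendsto
      (fun h : ℝ =>
        h ^ (-α) * grunwald (α - 1) (⌊x / h⌋₊ + 1 + 1) *
          f (x - ((⌊x / h⌋₊ : ℝ) + 1) * h))
      (nhdsWithin 0 (Set.Ioi 0))
      (nhds (f 0 * x ^ (-α) / Real.Gamma (1 - α))) := by
  have hG : Real.Gamma (1 - α) ≠ 0 := by
    apply Real.Gamma_ne_zero
    intro m hm
    rcases m with _ | _ | m
    · norm_num at hm; linarith
    · norm_num at hm; linarith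
    · push_cast at hm
      have : (0 : ℝ) ≤ m := m.cast_nonneg
      linarith
  have hid : Tendsto (fun h : ℝ => h) (nhdsWithin 0 (Set.Ioi 0)) (nhds 0) :=
    tendsto_nhdsWithin_of_tendsto_nhds tendsto_id
  have hdiv : Tendsto (fun h : ℝ => x / h) (nhdsWithin 0 (Set.Ioi 0)) atTop := by
    simpa [div_eq_mul_inv] using tendsto_inv_nhdsGT_zero.const_mul_atTop hx
  have hN : Tendsto (fun h : ℝ => ⌊x / h⌋₊ + 1) (nhdsWithin 0 (Set.Ioi 0)) atTop :=
    (tendsto_add_atTop_nat 1).comp (tendsto_nat_floor_atTop.comp hdiv)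
  have hdiff : Tendsto (fun h : ℝ => x - ((⌊x / h⌋₊ : ℝ) + 1) * h)
      (nhdsWithin 0 (Set.Ioi 0)) (nhds 0) := by
    refine tendsto_of_tendsto_of_tendsto_of_le_of_le' (g := fun h : ℝ => -h) (h := fun _ => 0)
      (by simpa using hid.neg) tendsto_const_nhds ?_ ?_
    · filter_upwards [self_mem_nhdsWithin] with h hh
      have hh : 0 < h := hh
      have h1 : (⌊x / h⌋₊ : ℝ) ≤ x / h := Nat.floor_le (by positivity)
      rw [le_div_iff₀ hh] at h1
      linarith
    · filter_upwards [self_mem_nhdsWithin] with h hh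
      have hh : 0 < h := hh
      have h1 : x / h < (⌊x / h⌋₊ : ℝ) + 1 := Nat.lt_floor_add_one _
      rw [div_lt_iff₀ hh] at h1
      linarith
  have hprod : Tendsto (fun h : ℝ => ((⌊x / h⌋₊ : ℝ) + 1) * h)
      (nhdsWithin 0 (Set.Ioi 0)) (nhds x) := by
    simpa using (tendsto_const_nhds (x := x)).sub hdiff
  have hpow := hprod.rpow_const (p := -α) (Or.inl hx.ne')
  have hGam := ((Real.GammaSeq_tendsto_Gamma (1 - α)).comp hN).inv₀ hG
  have hrat := (tendsto_natCast_div_add_atTop (1 : ℝ)).comp hN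
  have hff := hf.tendsto.comp hdiff
  have key := ((hpow.mul hrat).mul hGam).mul hff
  have e : x ^ (-α) * 1 * (Real.Gamma (1 - α))⁻¹ * f 0
      = f 0 * x ^ (-α) / Real.Gamma (1 - α) := by
    rw [div_eq_mul_inv]; ring
  rw [e] at key
  refine key.congr' ?_
  filter_upwards [self_mem_nhdsWithin] with h hh
  have hh : 0 < h := hh
  have hs : α - 1 = -(1 - α) := by ring
  have hn : (0 : ℝ) < (⌊x / h⌋₊ : ℝ) + 1 := by positivity
  rw [hs, grunwald_eq_gammaSeq _ _ (Nat.succ_pos _)]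
  simp only [Function.comp]
  push_cast
  rw [Real.mul_rpow hn.le hh.le, sub_eq_add_neg 1 α, Real.rpow_add hn, Real.rpow_one]
  ring
end

section
/- Let 1 < α < 2, let n ≥ 2 be an integer, and let β > 0 satisfy α·β ≤ 1. Let B = (b_{ij})_{0≤i,j≤n} be the iteration matrix of the explicit Euler scheme for the Riemann–Liouville fractional diffusion equation with absorbing boundary conditions: b_{ij} = g^α_{j−i+1} if 0 < j < n and i ≤ j+1, and b_{ij} = 0 otherwise. If u ∈ ℝ^{n+1} has nonnegative entries and u_0 = u_n = 0, then the total mass is non-increasing: ∑_{j=0}^n ( u_j + β·∑_{i=0}^n b_{ij}·u_i ) ≤ ∑_{j=0}^n u_j. That is, the absorbing-boundary Euler scheme only removes mass from the system. -/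
open Finset

theorem grunwald_nonneg (α : ℝ) (h1 : 1 < α) (h2 : α < 2) (m : ℕ) : 0 ≤ grunwald α (m + 2) := by
  induction m with
  | zero =>
    simp only [grunwald]
    norm_num
    nlinarith
  | succ k ih =>
    rw [show k + 1 + 2 = (k + 2) + 1 from rfl, grunwald]
    have hk : (0 : ℝ) ≤ (k : ℝ) := Nat.cast_nonneg k
    push_cast
    apply div_nonneg (mul_nonneg ih _) <;> linarith

theorem grunwald_sum (α : ℝ) (m : ℕ) :
    ((m : ℝ) + 1) * grunwald α (m + 1) = -α * ∑ k ∈ range (m + 1), grunwald α k := by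
  induction m with
  | zero => simp [grunwald]
  | succ k ih =>
    rw [sum_range_succ, mul_add, ← ih, grunwald]
    have hk : (0 : ℝ) ≤ (k : ℝ) := Nat.cast_nonneg k
    have : ((k + 1 : ℕ) : ℝ) + 1 ≠ 0 := by positivity
    field_simp
    push_cast
    ring

theorem grunwald_sum_nonpos (α : ℝ) (h1 : 1 < α) (h2 : α < 2) (m : ℕ) :
    ∑ k ∈ range (m + 2), grunwald α k ≤ 0 := by
  have h := grunwald_sum α (m + 1)
  have h3 := grunwald_nonneg α h1 h2 m
  have h4 : 0 ≤ (((m + 1 : ℕ) : ℝ) + 1) * grunwald α (m + 1 + 1) :=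
    mul_nonneg (by positivity) h3
  by_contra! hc
  nlinarith

theorem row_sum_nonpos (α : ℝ) (h1 : 1 < α) (h2 : α < 2) (n i : ℕ) (hi : 0 < i) (hin : i < n) :
    ∑ j ∈ range (n + 1), (if 0 < j ∧ j < n ∧ i ≤ j + 1 then
        grunwald α (j + 1 - i) else 0) ≤ 0 := by
  obtain ⟨m, rfl⟩ : ∃ m, n = i + 1 + m := ⟨n - (i + 1), by omega⟩
  rcases Nat.lt_or_ge i 2 with h | h
  · obtain rfl : i = 1 := by omega
    have h := grunwald_sum_nonpos α h1 h2 m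
    rw [sum_range_succ'] at h
    rw [sum_range_succ, show 1 + 1 + m = (m + 1) + 1 by omega, sum_range_succ']
    simp only [lt_irrefl, false_and, and_false, if_false, add_zero]
    have : grunwald α 0 = 1 := by simp [grunwald]
    refine le_trans (le_of_eq (sum_congr rfl (g := fun k => grunwald α (k + 1)) ?_)) (by linarith)
    intro x hx
    rw [mem_range] at hx
    rw [if_pos (by omega)]
    congr 1
  · obtain ⟨p, rfl⟩ : ∃ p, i = p + 2 := ⟨i - 2, by omega⟩
    have h := grunwald_sum_nonpos α h1 h2 m
    rw [sum_range_succ, if_neg (by omega), add_zero,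
      show p + 2 + 1 + m = (p + 1) + (m + 2) by omega, sum_range_add, sum_eq_zero, zero_add]
    · refine le_trans (le_of_eq (sum_congr rfl ?_)) h
      intro x hx
      rw [mem_range] at hx
      rw [if_pos (by omega)]
      congr 1
      omega
    · intro x hx
      rw [mem_range] at hx
      rw [if_neg (by omega)]

/-- The explicit Euler scheme for the Riemann–Liouville fractional diffusion
equation with absorbing boundary conditions only removes mass from the system:
with iteration matrix `b_{ij} = g^α_{j−i+1}` if `0 < j < n` and `i ≤ j+1`,
`b_{ij} = 0` otherwise, and `u ≥ 0` with `u_0 = u_n = 0`, the total mass after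
one step, `∑_j (u_j + β ∑_i b_{ij} u_i)`, is at most `∑_j u_j`. -/
theorem euler_absorbing_mass_decreasing (α : ℝ) (hα₁ : 1 < α) (hα₂ : α < 2)
    (n : ℕ) (hn : 2 ≤ n) (β : ℝ) (hβ : 0 < β) (hstep : α * β ≤ 1)
    (b : Fin (n + 1) → Fin (n + 1) → ℝ)
    (hb : ∀ i j : Fin (n + 1), b i j =
      if 0 < (j : ℕ) ∧ (j : ℕ) < n ∧ (i : ℕ) ≤ (j : ℕ) + 1 then
        grunwald α ((j : ℕ) + 1 - (i : ℕ)) else 0)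
    (u : Fin (n + 1) → ℝ) (hu : ∀ i, 0 ≤ u i)
    (hu0 : u 0 = 0) (hun : u (Fin.last n) = 0) :
    ∑ j, (u j + β * ∑ i, b i j * u i) ≤ ∑ j, u j := by
  rw [sum_add_distrib, ← mul_sum, sum_comm]
  have key : ∑ i, ∑ j, b i j * u i ≤ 0 := by
    apply sum_nonpos
    intro i _
    rw [← sum_mul]
    by_cases h0 : i = 0
    · rw [h0, hu0, mul_zero]
    by_cases hl : i = Fin.last n
    · rw [hl, hun, mul_zero]
    apply mul_nonpos_of_nonpos_of_nonneg _ (hu i)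
    simp only [hb]
    rw [Fin.sum_univ_eq_sum_range (fun j => if 0 < j ∧ j < n ∧ (i : ℕ) ≤ j + 1 then
        grunwald α (j + 1 - (i : ℕ)) else 0) (n + 1)]
    apply row_sum_nonpos α hα₁ hα₂
    · exact Nat.pos_of_ne_zero fun h => h0 (Fin.ext h)
    · have : (i : ℕ) ≠ n := fun h => hl (Fin.ext h)
      omega
  nlinarith
end
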